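/- Assume in addition that R' is a localization of a finitely generated R-algebra (R' is essentially of finite type over R) and that there exists a nonzero f ∈ R such that the induced homomorphism of localizations R_f → R'_{π(f)} is bijective (π is a local blowing up, an isomorphism away from f = 0). Then the height of the implicit ideal does not decrease: ht H' ≥ ht H. -/

import Mathlib

/-!
Statement context. Let `(R, M)` be a noetherian local domain which is not a field, with field of
fractions `K`, and let `ν : K → ℝ≥0` be a (multiplicatively written) valuation which is ≤ 1 on `R`
and < 1 on `M` (i.e. `ν` is a nontrivial rank-one valuation centered at `R`).  For `γ ∈ ℝ≥0` let
`𝒫_γ = {x ∈ R | ν x ≤ γ}` and let `Φ = ν(R \ {0})`.  Then the implicit ideal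
`H = ⋂_{γ ∈ Φ} 𝒫_γ·R̂` of the `M`-adic completion `R̂` of `R` is prime.
-/

open IsLocalRing
open scoped NNReal

/-- The valuation ideal `𝒫_γ = {x ∈ R | ν (f x) ≤ γ}`, for a valuation `ν` on a ring `K`
and a ring homomorphism `f : R → K` such that `ν ∘ f` is bounded by `1` on `R`. -/
def valIdeal {R K : Type*} [CommRing R] [CommRing K] (f : R →+* K)
    (ν : Valuation K ℝ≥0) (hν : ∀ x : R, ν (f x) ≤ 1) (γ : ℝ≥0) : Ideal R where
  carrier := {x : R | ν (f x) ≤ γ}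
  add_mem' := fun {a b} ha hb => by
    simp only [Set.mem_setOf_eq, map_add] at *
    exact le_trans (ν.map_add _ _) (max_le ha hb)
  zero_mem' := by simp
  smul_mem' := fun c x hx => by
    simp only [smul_eq_mul, Set.mem_setOf_eq, map_mul] at *
    calc ν (f c) * ν (f x) ≤ 1 * γ := mul_le_mul' (hν c) hx
      _ = γ := one_mul γ

/-- The value semigroup `Φ = ν(R \ {0})`. -/
def valSemigroup {R K : Type*} [CommRing R] [CommRing K] (f : R →+* K)
    (ν : Valuation K ℝ≥0) : Set ℝ≥0 :=
  {γ : ℝ≥0 | ∃ x : R, x ≠ 0 ∧ ν (f x) = γ}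

/-- The implicit ideal `H = ⋂_{γ ∈ Φ} 𝒫_γ·R̂` of the `M`-adic completion `R̂` of a local
ring `R`. -/
noncomputable def implicitIdeal {R K : Type*} [CommRing R] [IsLocalRing R] [CommRing K]
    (f : R →+* K) (ν : Valuation K ℝ≥0) (hν : ∀ x : R, ν (f x) ≤ 1) :
    Ideal (AdicCompletion (maximalIdeal R) R) :=
  ⨅ γ ∈ valSemigroup f ν,
    Ideal.map (algebraMap R (AdicCompletion (maximalIdeal R) R)) (valIdeal f ν hν γ)

/-- If `π(M) ⊆ M'` then `M^n ≤ (M'^n).comap π`. -/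
theorem pow_le_comap_pow {R R' : Type*} [CommRing R] [CommRing R'] {M : Ideal R} {M' : Ideal R'}
    (π : R →+* R') (h : ∀ x ∈ M, π x ∈ M') (n : ℕ) : M ^ n ≤ (M' ^ n).comap π := by
  rw [← Ideal.map_le_iff_le_comap, Ideal.map_pow]
  exact Ideal.pow_right_mono (Ideal.map_le_iff_le_comap.mpr h) n

/-- `πhat : R̂ → R̂'` is *the* ring homomorphism induced on the `M`-adic (resp. `M'`-adic)
completions by a local homomorphism `π : R → R'`: it is characterized by its compatibility
with the canonical projections `R̂ → R/Mⁿ`, `R̂' → R'/M'ⁿ` and the homomorphisms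
`R/Mⁿ → R'/M'ⁿ` induced by `π` (such a compatible homomorphism is unique, because an element
of an adic completion is determined by its images in all the quotients). -/
def IsInducedCompletionHom {R R' : Type*} [CommRing R] [CommRing R']
    [IsLocalRing R] [IsLocalRing R']
    (π : R →+* R') (hπ : ∀ x ∈ maximalIdeal R, π x ∈ maximalIdeal R')
    (πhat : AdicCompletion (maximalIdeal R) R →+* AdicCompletion (maximalIdeal R') R') : Prop :=
  ∀ (n : ℕ) (x : AdicCompletion (maximalIdeal R) R),
    AdicCompletion.evalₐ (maximalIdeal R') n (πhat x) =
      Ideal.quotientMap ((maximalIdeal R') ^ n) π (pow_le_comap_pow π hπ n)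
        (AdicCompletion.evalₐ (maximalIdeal R) n x)

/-- The height of an ideal: the infimum of the heights of the prime ideals containing it. -/
noncomputable def idealHeight {A : Type*} [CommRing A] (I : Ideal A) : ℕ∞ :=
  ⨅ P ∈ {P : PrimeSpectrum A | I ≤ P.asIdeal}, Order.height P

section
variable {R : Type*} [CommRing R] (I : Ideal R)

theorem AdicCompletion.mem_map_pow_iff_evalₐ_eq_zero (hI : I.FG) (n : ℕ)
    (x : AdicCompletion I R) :
    x ∈ I.map (algebraMap R (AdicCompletion I R)) ^ n ↔ AdicCompletion.evalₐ I n x = 0 := by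
  have h1 : x ∈ (I ^ n • ⊤ : Submodule R (AdicCompletion I R)) ↔
      x ∈ (AdicCompletion.eval I R n).ker := by
    rw [AdicCompletion.pow_smul_top_eq_ker_eval hI]
  rw [← Ideal.map_pow]
  have h2 : x ∈ (I ^ n • ⊤ : Submodule R (AdicCompletion I R)) ↔
      x ∈ (I ^ n).map (algebraMap R (AdicCompletion I R)) := by
    rw [Ideal.smul_top_eq_map]; rfl
  rw [← h2, h1, LinearMap.mem_ker]
  have hle : I ^ n • ⊤ ≤ I ^ n := by simp
  have hle' : I ^ n ≤ I ^ n • ⊤ := by simp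
  constructor
  · intro h
    rw [← AdicCompletion.factor_eval_eq_evalₐ I x hle, h, _root_.map_zero]
  · intro h
    rw [← AdicCompletion.factor_evalₐ_eq_eval I x hle', h, _root_.map_zero]

theorem AdicCompletion.evalₐ_algebraMap (n : ℕ) (r : R) :
    AdicCompletion.evalₐ I n (algebraMap R _ r) = Ideal.Quotient.mk (I ^ n) r := by
  simp

theorem AdicCompletion.exists_sub_algebraMap_mem (hI : I.FG) (n : ℕ) (x : AdicCompletion I R) :
    ∃ r : R, x - algebraMap R _ r ∈ I.map (algebraMap R (AdicCompletion I R)) ^ n := by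
  obtain ⟨r, hr⟩ := Ideal.Quotient.mk_surjective (AdicCompletion.evalₐ I n x)
  refine ⟨r, ?_⟩
  rw [mem_map_pow_iff_evalₐ_eq_zero I hI, map_sub, evalₐ_algebraMap, hr, sub_self]

theorem AdicCompletion.algebraMap_mem_map_pow_iff (hI : I.FG) (n : ℕ) (r : R) :
    algebraMap R _ r ∈ I.map (algebraMap R (AdicCompletion I R)) ^ n ↔ r ∈ I ^ n := by
  rw [mem_map_pow_iff_evalₐ_eq_zero I hI, evalₐ_algebraMap, Ideal.Quotient.eq_zero_iff_mem]

theorem AdicCompletion.eq_zero_of_forall_mem_map_pow (hI : I.FG) (x : AdicCompletion I R)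
    (h : ∀ n, x ∈ I.map (algebraMap R (AdicCompletion I R)) ^ n) : x = 0 := by
  refine AdicCompletion.ext_evalₐ fun n ↦ ?_
  rw [(mem_map_pow_iff_evalₐ_eq_zero I hI n x).1 (h n), _root_.map_zero]

theorem AdicCompletion.exists_limit (hI : I.FG) (b : ℕ → AdicCompletion I R)
    (hb : ∀ n, b (n + 1) - b n ∈ I.map (algebraMap R (AdicCompletion I R)) ^ n) :
    ∃ L, ∀ n, L - b n ∈ I.map (algebraMap R (AdicCompletion I R)) ^ n := by
  have hmem (n : ℕ) (x : AdicCompletion I R) :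
      x ∈ (I ^ n • ⊤ : Submodule R (AdicCompletion I R)) ↔
      x ∈ I.map (algebraMap R (AdicCompletion I R)) ^ n := by
    rw [← Ideal.map_pow, Ideal.smul_top_eq_map]; rfl
  have := AdicCompletion.isAdicComplete (I := I) (M := R) hI
  have hmn : ∀ m k, b (m + k) - b m ∈ I.map (algebraMap R (AdicCompletion I R)) ^ m := by
    intro m k
    induction k with
    | zero => simp
    | succ k ih =>
      have := add_mem (Ideal.pow_le_pow_right (Nat.le_add_right m k) (hb (m + k))) ih
      simpa [add_assoc] using this
  obtain ⟨L, hL⟩ := IsPrecomplete.prec' (I := I) b (by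
    intro m n h
    obtain ⟨k, rfl⟩ := Nat.exists_eq_add_of_le h
    rw [SModEq.comm, SModEq.sub_mem, hmem]
    exact hmn m k)
  refine ⟨L, fun n ↦ ?_⟩
  have := hL n
  rwa [SModEq.comm, SModEq.sub_mem, hmem] at this

/-- The ideal of initial forms (in the Rees algebra of `I`) of an ideal `J` of the completion. -/
def AdicCompletion.initialFormIdeal (J : Ideal (AdicCompletion I R)) : Ideal (reesAlgebra I) where
  carrier := {p | ∀ n, ∃ j ∈ J, j ∈ I.map (algebraMap R (AdicCompletion I R)) ^ n ∧
    j - algebraMap R _ ((p : Polynomial R).coeff n) ∈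
      I.map (algebraMap R (AdicCompletion I R)) ^ (n + 1)}
  add_mem' := by
    intro p q hp hq n
    obtain ⟨j, hj, hj1, hj2⟩ := hp n
    obtain ⟨k, hk, hk1, hk2⟩ := hq n
    refine ⟨j + k, add_mem hj hk, add_mem hj1 hk1, ?_⟩
    convert add_mem hj2 hk2 using 1
    simp only [Subalgebra.coe_add, Polynomial.coeff_add, map_add]
    ring
  zero_mem' := fun n ↦ ⟨0, by simp⟩
  smul_mem' := by
    intro c p hp n
    choose j hj hj1 hj2 using hp
    have hc (i : ℕ) : algebraMap R (AdicCompletion I R) ((c : Polynomial R).coeff i) ∈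
        I.map (algebraMap R (AdicCompletion I R)) ^ i := by
      rw [← Ideal.map_pow]
      exact Ideal.mem_map_of_mem _ (c.2 i)
    refine ⟨∑ x ∈ Finset.HasAntidiagonal.antidiagonal n,
      algebraMap R _ ((c : Polynomial R).coeff x.1) * j x.2, ?_, ?_, ?_⟩
    · exact sum_mem fun x _ ↦ J.mul_mem_left _ (hj _)
    · refine sum_mem fun x hx ↦ ?_
      rw [← Finset.HasAntidiagonal.mem_antidiagonal.1 hx, pow_add]
      exact Ideal.mul_mem_mul (hc _) (hj1 _)
    · rw [smul_eq_mul, Subalgebra.coe_mul, Polynomial.coeff_mul, map_sum, ← Finset.sum_sub_distrib]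
      refine sum_mem fun x hx ↦ ?_
      rw [← Finset.HasAntidiagonal.mem_antidiagonal.1 hx, map_mul, ← mul_sub, add_assoc, pow_add]
      exact Ideal.mul_mem_mul (hc _) (hj2 _)

/-- Successive approximation: an ideal of the completion whose elements can be approximated
by combinations of finitely many of its elements `g t` is generated by these elements. -/
theorem AdicCompletion.le_span_of_forall_exists_sub_mem (hI : I.FG)
    (J : Ideal (AdicCompletion I R)) {T : Type*} [Fintype T] (g : T → AdicCompletion I R) (D : ℕ)
    (hg : ∀ n, ∀ x ∈ J, x ∈ I.map (algebraMap R (AdicCompletion I R)) ^ n →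
      ∃ a : T → AdicCompletion I R,
        (∀ t, a t ∈ I.map (algebraMap R (AdicCompletion I R)) ^ (n - D)) ∧
        x - ∑ t, a t * g t ∈ J ∧
        x - ∑ t, a t * g t ∈ I.map (algebraMap R (AdicCompletion I R)) ^ (n + 1)) :
    J ≤ Ideal.span (Set.range g) := by
  intro x hx
  set F := I.map (algebraMap R (AdicCompletion I R)) with hF
  have hg' : ∀ n, ∀ x : AdicCompletion I R, ∃ a : T → AdicCompletion I R,
      x ∈ J → x ∈ F ^ n → (∀ t, a t ∈ F ^ (n - D)) ∧
        x - ∑ t, a t * g t ∈ J ∧ x - ∑ t, a t * g t ∈ F ^ (n + 1) := by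
    intro n x
    by_cases h : x ∈ J ∧ x ∈ F ^ n
    · obtain ⟨a, ha⟩ := hg n x h.1 h.2
      exact ⟨a, fun _ _ ↦ ha⟩
    · exact ⟨0, fun h1 h2 ↦ (h ⟨h1, h2⟩).elim⟩
  choose a ha using hg'
  let y : ℕ → AdicCompletion I R := fun n ↦ Nat.rec x (fun n z ↦ z - ∑ t, a n z t * g t) n
  have hy0 : y 0 = x := rfl
  have hys (n : ℕ) : y (n + 1) = y n - ∑ t, a n (y n) t * g t := rfl
  have hy (n : ℕ) : y n ∈ J ∧ y n ∈ F ^ n := by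
    induction n with
    | zero => simpa [hy0] using hx
    | succ n ih =>
      rw [hys]
      exact (ha n (y n) ih.1 ih.2).2
  let b : T → ℕ → AdicCompletion I R := fun t n ↦ ∑ k ∈ Finset.range n, a k (y k) t
  have hyb (n : ℕ) : x - ∑ t, b t n * g t = y n := by
    induction n with
    | zero => simp [b, hy0]
    | succ n ih =>
      rw [hys]
      simp only [b, Finset.sum_range_succ, add_mul, Finset.sum_add_distrib]
      rw [← sub_sub, ih]
  have hlim (t : T) : ∃ L, ∀ n, L - b t (n + D) ∈ F ^ n := by
    refine exists_limit I hI (fun n ↦ b t (n + D)) fun n ↦ ?_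
    have : b t (n + 1 + D) - b t (n + D) = a (n + D) (y (n + D)) t := by
      rw [add_right_comm]
      simp [b, Finset.sum_range_succ]
    rw [this]
    simpa using (ha (n + D) _ (hy _).1 (hy _).2).1 t
  choose L hL using hlim
  have key : x - ∑ t, L t * g t = 0 := by
    refine eq_zero_of_forall_mem_map_pow I hI _ fun n ↦ ?_
    have h1 : x - ∑ t, L t * g t = y (n + D) - ∑ t, (L t - b t (n + D)) * g t := by
      rw [← hyb]
      simp only [sub_mul, Finset.sum_sub_distrib]
      ring
    rw [h1]
    refine sub_mem (Ideal.pow_le_pow_right (Nat.le_add_right n D) (hy _).2) ?_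
    exact sum_mem fun t _ ↦ Ideal.mul_mem_right _ _ (hL t n)
  rw [sub_eq_zero.1 key]
  exact sum_mem fun t _ ↦ Ideal.mul_mem_left _ _ (Ideal.subset_span ⟨t, rfl⟩)

open Polynomial in
/-- The adic completion of a noetherian ring is noetherian. -/
theorem AdicCompletion.isNoetherianRing [IsNoetherianRing R] :
    IsNoetherianRing (AdicCompletion I R) := by
  classical
  rw [isNoetherianRing_iff_ideal_fg]
  intro J
  have hI : I.FG := I.fg_of_isNoetherianRing
  obtain ⟨S, hS⟩ := (initialFormIdeal I J).fg_of_isNoetherianRing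
  have hmem (s : S) : (s : reesAlgebra I) ∈ initialFormIdeal I J := by
    rw [← hS]; exact Ideal.subset_span s.2
  choose j hj hj1 hj2 using hmem
  let D := S.sup fun s ↦ (s : R[X]).natDegree + 1
  let g : S × Fin D → AdicCompletion I R := fun t ↦ j t.1 t.2
  refine Submodule.fg_def.2 ⟨Set.range g, Set.finite_range g, le_antisymm ?_ ?_⟩
  · rw [Submodule.span_le]
    rintro _ ⟨t, rfl⟩
    exact hj _ _
  refine le_span_of_forall_exists_sub_mem I hI J g D fun n x hx hxn ↦ ?_
  obtain ⟨r, hr⟩ := exists_sub_algebraMap_mem I hI (n + 1) x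
  have hrn : r ∈ I ^ n := by
    rw [← algebraMap_mem_map_pow_iff I hI]
    simpa using sub_mem hxn (Ideal.pow_le_pow_right n.le_succ hr)
  have hmon : (⟨monomial n r, reesAlgebra.monomial_mem.2 hrn⟩ : reesAlgebra I) ∈
      initialFormIdeal I J := by
    intro m
    by_cases h : n = m
    · subst h
      exact ⟨x, hx, hxn, by simpa using hr⟩
    · exact ⟨0, by simp [coeff_monomial, h]⟩
  have hS' : (S : Set (reesAlgebra I)) = Set.range ((↑) : S → reesAlgebra I) := by simp
  rw [← hS, hS', Submodule.mem_span_range_iff_exists_fun] at hmon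
  obtain ⟨c, hc⟩ := hmon
  let q : S × Fin D → R := fun t ↦
    if (t.2 : ℕ) ≤ n then (c t.1 : R[X]).coeff (n - t.2) else 0
  have hq (t) : algebraMap R (AdicCompletion I R) (q t) ∈
      I.map (algebraMap R (AdicCompletion I R)) ^ (n - t.2) := by
    rw [algebraMap_mem_map_pow_iff I hI]
    simp only [q]
    split_ifs
    · exact (c t.1).2 _
    · exact zero_mem _
  have hrsum : r = ∑ t : S × Fin D, q t * (t.1 : R[X]).coeff t.2 := by
    have := congrArg (fun p : reesAlgebra I ↦ (p : R[X]).coeff n) hc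
    simp only [coeff_monomial, if_true, AddSubmonoidClass.coe_finsetSum, finsetSum_coeff,
      smul_eq_mul, Subalgebra.coe_mul] at this
    rw [← this, Fintype.sum_prod_type]
    refine Finset.sum_congr rfl fun s _ ↦ ?_
    rw [mul_comm, coeff_mul, Finset.Nat.sum_antidiagonal_eq_sum_range_succ_mk,
      Fin.sum_univ_eq_sum_range (fun i ↦ (if i ≤ n then (c s : R[X]).coeff (n - i) else 0) *
        (s : R[X]).coeff i) D]
    simp only [ite_mul, zero_mul]
    rw [← Finset.sum_filter]
    refine (Finset.sum_subset_zero_on_sdiff ?_ ?_ ?_).symm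
    · intro i hi
      simp only [Finset.mem_filter, Finset.mem_range] at hi ⊢
      lia
    · intro i hi
      have : ((s : reesAlgebra I) : R[X]).natDegree + 1 ≤ D :=
        Finset.le_sup (f := fun s : reesAlgebra I ↦ (s : R[X]).natDegree + 1) s.2
      simp only [Finset.mem_sdiff, Finset.mem_filter, Finset.mem_range] at hi
      rw [coeff_eq_zero_of_natDegree_lt (by lia), zero_mul]
    · intro i hi
      rw [mul_comm]
  refine ⟨fun t ↦ algebraMap R _ (q t), fun t ↦ Ideal.pow_le_pow_right (by lia) (hq t),
    sub_mem hx (sum_mem fun t _ ↦ J.mul_mem_left _ (hj _ _)), ?_⟩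
  have hx' : x - ∑ t, algebraMap R (AdicCompletion I R) (q t) * g t =
      (x - algebraMap R _ r) - ∑ t, algebraMap R (AdicCompletion I R) (q t) *
        (g t - algebraMap R _ ((t.1 : R[X]).coeff t.2)) := by
    simp only [mul_sub, Finset.sum_sub_distrib, ← map_mul, ← map_sum, ← hrsum]
    ring
  rw [hx']
  refine sub_mem hr (sum_mem fun t _ ↦ ?_)
  by_cases ht : (t.2 : ℕ) ≤ n
  · rw [show n + 1 = (n - t.2) + (t.2 + 1) by lia, pow_add]
    exact Ideal.mul_mem_mul (hq t) (hj2 _ _)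
  · simp [q, ht]
end

section
variable {R S : Type*} [CommRing R] [CommRing S]

theorem AdicCompletion.factorPow_evalₐ (I : Ideal R) {m n : ℕ} (h : m ≤ n)
    (x : AdicCompletion I R) :
    Ideal.Quotient.factorPow I h (evalₐ I n x) = evalₐ I m x := by
  induction x using AdicCompletion.induction_on with
  | _ x =>
    rw [evalₐ_mk, evalₐ_mk, ← Ideal.mk_eq_mk I h x]
    simp

/-- Compatible isomorphisms `S ⧸ N ^ n ≃ R ⧸ I ^ n` induce an isomorphism of the completions. -/
noncomputable def AdicCompletion.ringEquivOfQuotients (I : Ideal R) (N : Ideal S)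
    (e : ∀ n, S ⧸ N ^ n ≃+* R ⧸ I ^ n)
    (he : ∀ {m n : ℕ} (h : m ≤ n) (x : S ⧸ N ^ n),
      Ideal.Quotient.factorPow I h (e n x) = e m (Ideal.Quotient.factorPow N h x)) :
    AdicCompletion N S ≃+* AdicCompletion I R :=
  RingEquiv.ofRingHom
    (liftRingHom I (fun n ↦ (e n).toRingHom.comp (evalₐ N n : AdicCompletion N S →+* S ⧸ N ^ n))
      (fun h ↦ by
        ext x
        simp [he, factorPow_evalₐ]))
    (liftRingHom N (fun n ↦ (e n).symm.toRingHom.comp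
        (evalₐ I n : AdicCompletion I R →+* R ⧸ I ^ n))
      (fun {m n} h ↦ by
        ext x
        apply (e m).injective
        simp [← he, factorPow_evalₐ]))
    (by
      ext x : 1
      refine ext_evalₐ fun n ↦ ?_
      simp only [RingHom.comp_apply, RingHom.id_apply, evalₐ_liftRingHom]
      exact (congrArg (e n) (evalₐ_liftRingHom N _ _ n x)).trans (by simp))
    (by
      ext x : 1
      refine ext_evalₐ fun n ↦ ?_
      simp only [RingHom.comp_apply, RingHom.id_apply, evalₐ_liftRingHom]
      exact (congrArg (e n).symm (evalₐ_liftRingHom I _ _ n x)).trans (by simp))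

theorem AdicCompletion.evalₐ_ringEquivOfQuotients (I : Ideal R) (N : Ideal S)
    (e : ∀ n, S ⧸ N ^ n ≃+* R ⧸ I ^ n)
    (he : ∀ {m n : ℕ} (h : m ≤ n) (x : S ⧸ N ^ n),
      Ideal.Quotient.factorPow I h (e n x) = e m (Ideal.Quotient.factorPow N h x))
    (n : ℕ) (x : AdicCompletion N S) :
    evalₐ I n (ringEquivOfQuotients I N e he x) = e n (evalₐ N n x) :=
  evalₐ_liftRingHom I _ (fun h ↦ by ext x; simp [he, factorPow_evalₐ]) n x

end

section
variable {A S : Type*} [CommRing A] [CommRing S] [Algebra A S]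

/-- If `A → S` is injective and becomes bijective after inverting `f`, then contracting a prime
ideal of `S` not containing `f` to `A` preserves its height. -/
theorem Ideal.height_under_eq_of_away (hinj : Function.Injective (algebraMap A S)) (f : A)
    (hf : ∀ s : S, ∃ (n : ℕ) (a : A), algebraMap A S f ^ n * s = algebraMap A S a)
    (Q : Ideal S) [Q.IsPrime] (hQ : algebraMap A S f ∉ Q) :
    (Q.under A).height = Q.height := by
  let T := Localization.Away (algebraMap A S f)
  have hu : IsUnit (algebraMap S T (algebraMap A S f)) :=
    IsLocalization.Away.algebraMap_isUnit _
  have hTloc : IsLocalization.Away f T := by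
    refine ⟨?_, ?_, ?_⟩
    · rintro ⟨_, n, rfl⟩
      rw [map_pow, IsScalarTower.algebraMap_apply A S T]
      exact hu.pow n
    · intro z
      obtain ⟨⟨s, ⟨_, m, rfl⟩⟩, hs⟩ :=
        IsLocalization.surj (Submonoid.powers (algebraMap A S f)) z
      obtain ⟨n, a, ha⟩ := hf s
      refine ⟨⟨a, ⟨f ^ (n + m), n + m, rfl⟩⟩, ?_⟩
      simp only [IsScalarTower.algebraMap_apply A S T, ← ha, map_mul, map_pow, pow_add] at hs ⊢
      rw [← hs]
      ring
    · intro x y hxy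
      rw [IsScalarTower.algebraMap_apply A S T, IsScalarTower.algebraMap_apply A S T] at hxy
      obtain ⟨⟨_, m, rfl⟩, hm⟩ :=
        IsLocalization.exists_of_eq (M := Submonoid.powers (algebraMap A S f)) hxy
      refine ⟨⟨f ^ m, m, rfl⟩, hinj ?_⟩
      simpa only [map_mul, map_pow] using hm
  have hdisj : Disjoint (Submonoid.powers (algebraMap A S f) : Set S) (Q : Set S) := by
    rwa [Ideal.disjoint_powers_iff_notMem _ (Ideal.IsPrime.isRadical inferInstance)]
  have h2 : (Q.map (algebraMap S T)).under S = Q :=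
    IsLocalization.under_map_of_isPrime_disjoint (Submonoid.powers (algebraMap A S f)) T
      inferInstance hdisj
  have h3 := IsLocalization.height_under (Submonoid.powers (algebraMap A S f))
    (Q.map (algebraMap S T))
  have h4 := IsLocalization.height_under (Submonoid.powers f) (Q.map (algebraMap S T))
  rw [h2] at h3
  rw [h3, ← h4, ← Ideal.under_under (B := S) (Q.map (algebraMap S T)), h2]

theorem Ideal.height_under_adicCompletion_le [IsNoetherianRing S] (N : Ideal S)
    (P : Ideal (AdicCompletion N S)) [P.IsPrime] : (P.under S).height ≤ P.height := by
  have := AdicCompletion.isNoetherianRing N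
  rw [Ideal.height_eq_height_add_of_liesOver_of_hasGoingDown (P.under S) P]
  exact le_self_add

end

section
open TensorProduct

variable {R R' : Type*} [CommRing R] [CommRing R'] [Algebra R R'] (I : Ideal R) (I' : Ideal R')

/-- The projections `R̂ ⊗[R] R' → R' ⧸ I' ^ n`. -/
noncomputable def AdicCompletion.tensorEval (h : I ≤ I'.comap (algebraMap R R')) (n : ℕ) :
    AdicCompletion I R ⊗[R] R' →ₐ[R] R' ⧸ I' ^ n :=
  Algebra.TensorProduct.productMap
    ((Ideal.quotientMapₐ (I' ^ n) (Algebra.ofId R R')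
      (pow_le_comap_pow (algebraMap R R') h n)).comp (evalₐ I n))
    (Ideal.Quotient.mkₐ R (I' ^ n))

theorem AdicCompletion.tensorEval_one_tmul (h : I ≤ I'.comap (algebraMap R R')) (n : ℕ) (x : R') :
    tensorEval I I' h n (1 ⊗ₜ x) = Ideal.Quotient.mk _ x := by
  simp [tensorEval]

theorem AdicCompletion.tensorEval_surjective (h : I ≤ I'.comap (algebraMap R R')) (n : ℕ) :
    Function.Surjective (tensorEval I I' h n) := by
  intro y
  obtain ⟨x, rfl⟩ := Ideal.Quotient.mk_surjective y
  exact ⟨1 ⊗ₜ x, tensorEval_one_tmul I I' h n x⟩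

theorem AdicCompletion.ker_tensorEval (hI : I.FG) (h : I ≤ I'.comap (algebraMap R R')) (n : ℕ) :
    RingHom.ker (tensorEval I I' h n) =
      (I'.map (Algebra.TensorProduct.includeRight :
        R' →ₐ[R] AdicCompletion I R ⊗[R] R')) ^ n := by
  set N := I'.map (Algebra.TensorProduct.includeRight :
        R' →ₐ[R] AdicCompletion I R ⊗[R] R') with hN
  have hsub {x : R'} {k : ℕ} (hx : x ∈ I' ^ k) : (1 : AdicCompletion I R) ⊗ₜ[R] x ∈ N ^ k := by
    rw [hN, ← Ideal.map_pow]
    exact Ideal.mem_map_of_mem (Algebra.TensorProduct.includeRight :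
        R' →ₐ[R] AdicCompletion I R ⊗[R] R') hx
  have hle : N ^ n ≤ RingHom.ker (tensorEval I I' h n) := by
    rw [hN, ← Ideal.map_pow, Ideal.map_le_iff_le_comap]
    intro x hx
    rw [Ideal.mem_comap, RingHom.mem_ker, Algebra.TensorProduct.includeRight_apply,
      tensorEval_one_tmul, Ideal.Quotient.eq_zero_iff_mem]
    exact hx
  refine le_antisymm ?_ hle
  · have hrep (s : AdicCompletion I R ⊗[R] R') : ∃ x : R', s - 1 ⊗ₜ x ∈ N ^ n := by
      induction s with
      | zero => exact ⟨0, by simp⟩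
      | add s t hs ht =>
        obtain ⟨x, hx⟩ := hs
        obtain ⟨y, hy⟩ := ht
        refine ⟨x + y, ?_⟩
        rw [TensorProduct.tmul_add, add_sub_add_comm]
        exact add_mem hx hy
      | tmul a x =>
        obtain ⟨r, hr⟩ := exists_sub_algebraMap_mem I hI n a
        refine ⟨algebraMap R R' r * x, ?_⟩
        have h1 : (a ⊗ₜ x - 1 ⊗ₜ (algebraMap R R' r * x) : AdicCompletion I R ⊗[R] R') =
            ((a - algebraMap R _ r) ⊗ₜ 1) * (1 ⊗ₜ x) := by
          rw [Algebra.TensorProduct.tmul_mul_tmul, mul_one, one_mul, TensorProduct.sub_tmul,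
            ← Algebra.smul_def, Algebra.algebraMap_eq_smul_one, TensorProduct.smul_tmul]
        rw [h1]
        refine Ideal.mul_mem_right _ _ ?_
        have h2 : (I.map (algebraMap R (AdicCompletion I R))) ^ n ≤
            (N ^ n).comap (algebraMap (AdicCompletion I R) (AdicCompletion I R ⊗[R] R')) := by
          refine pow_le_comap_pow _ ?_ n
          change _ ≤ N.comap _
          rw [Ideal.map_le_iff_le_comap]
          intro i hi
          have := hsub (k := 1) (x := algebraMap R R' i) (by simpa using h hi)
          rw [pow_one] at this
          rwa [Algebra.algebraMap_eq_smul_one, ← TensorProduct.smul_tmul,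
            ← Algebra.algebraMap_eq_smul_one] at this
        exact h2 hr
    intro s hs
    obtain ⟨x, hx⟩ := hrep s
    have hx0 : x ∈ I' ^ n := by
      rw [← Ideal.Quotient.eq_zero_iff_mem, ← tensorEval_one_tmul I I' h n x]
      have := sub_mem hs (hle hx)
      simpa using this
    simpa using add_mem hx (hsub hx0)

/-- The isomorphism `R̂ ⊗[R] R' ⧸ (I' (R̂ ⊗[R] R')) ^ n ≃ R' ⧸ I' ^ n`. -/
noncomputable def AdicCompletion.tensorQuotientEquiv (hI : I.FG)
    (h : I ≤ I'.comap (algebraMap R R')) (n : ℕ) :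
    (AdicCompletion I R ⊗[R] R') ⧸ (I'.map (Algebra.TensorProduct.includeRight :
        R' →ₐ[R] AdicCompletion I R ⊗[R] R')) ^ n ≃+* R' ⧸ I' ^ n :=
  (Ideal.quotEquivOfEq (ker_tensorEval I I' hI h n).symm).trans
    (RingHom.quotientKerEquivOfSurjective (f := (tensorEval I I' h n).toRingHom)
      (tensorEval_surjective I I' h n))

theorem AdicCompletion.tensorQuotientEquiv_mk (hI : I.FG)
    (h : I ≤ I'.comap (algebraMap R R')) (n : ℕ) (x : AdicCompletion I R ⊗[R] R') :
    tensorQuotientEquiv I I' hI h n (Ideal.Quotient.mk _ x) = tensorEval I I' h n x := by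
  rfl

theorem AdicCompletion.factorPow_tensorEval
    (h : I ≤ I'.comap (algebraMap R R')) {m n : ℕ} (hmn : m ≤ n) (x : AdicCompletion I R ⊗[R] R') :
    Ideal.Quotient.factorPow I' hmn (tensorEval I I' h n x) = tensorEval I I' h m x := by
  induction x with
  | zero => simp
  | add x y hx hy => simp only [_root_.map_add, hx, hy]
  | tmul a x =>
    have : Ideal.Quotient.factorPow I' hmn (Ideal.quotientMap (I' ^ n) (algebraMap R R')
        (pow_le_comap_pow (algebraMap R R') h n) (evalₐ I n a)) =
        Ideal.quotientMap (I' ^ m) (algebraMap R R')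
        (pow_le_comap_pow (algebraMap R R') h m) (evalₐ I m a) := by
      rw [← factorPow_evalₐ I hmn a]
      obtain ⟨r, hr⟩ := Ideal.Quotient.mk_surjective (evalₐ I n a)
      rw [← hr]
      rfl
    simp only [tensorEval, Algebra.TensorProduct.productMap_apply_tmul, map_mul]
    exact congrArg₂ _ this (by simp)

theorem AdicCompletion.factorPow_tensorQuotientEquiv (hI : I.FG)
    (h : I ≤ I'.comap (algebraMap R R')) {m n : ℕ} (hmn : m ≤ n)
    (x : (AdicCompletion I R ⊗[R] R') ⧸ (I'.map (Algebra.TensorProduct.includeRight :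
        R' →ₐ[R] AdicCompletion I R ⊗[R] R')) ^ n) :
    Ideal.Quotient.factorPow I' hmn (tensorQuotientEquiv I I' hI h n x) =
      tensorQuotientEquiv I I' hI h m (Ideal.Quotient.factorPow _ hmn x) := by
  obtain ⟨x, rfl⟩ := Ideal.Quotient.mk_surjective x
  rw [tensorQuotientEquiv_mk, factorPow_tensorEval]
  rfl

/-- The completion of `R̂ ⊗[R] R'` along `I'` is the completion of `R'` along `I'`. -/
noncomputable def AdicCompletion.tensorCompletionEquiv (hI : I.FG)
    (h : I ≤ I'.comap (algebraMap R R')) :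
    AdicCompletion (I'.map (Algebra.TensorProduct.includeRight :
        R' →ₐ[R] AdicCompletion I R ⊗[R] R')) (AdicCompletion I R ⊗[R] R') ≃+*
      AdicCompletion I' R' :=
  ringEquivOfQuotients I' _ (tensorQuotientEquiv I I' hI h)
    (factorPow_tensorQuotientEquiv I I' hI h)

theorem AdicCompletion.tensorCompletionEquiv_algebraMap (hI : I.FG)
    (h : I ≤ I'.comap (algebraMap R R')) (x : R') :
    tensorCompletionEquiv I I' hI h (algebraMap (AdicCompletion I R ⊗[R] R') _ (1 ⊗ₜ x)) =
      algebraMap R' _ x := by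
  refine ext_evalₐ fun n ↦ ?_
  rw [tensorCompletionEquiv, evalₐ_ringEquivOfQuotients _ _ _ (factorPow_tensorQuotientEquiv I I' hI h),
    evalₐ_algebraMap, evalₐ_algebraMap, tensorQuotientEquiv_mk, tensorEval_one_tmul]

theorem AdicCompletion.algebraMap_tmul_eq (r : R) :
    algebraMap (AdicCompletion I R) (AdicCompletion I R ⊗[R] R') (algebraMap R _ r) =
      1 ⊗ₜ algebraMap R R' r := by
  rw [Algebra.TensorProduct.algebraMap_apply, Algebra.algebraMap_self_apply,
    Algebra.algebraMap_eq_smul_one, Algebra.algebraMap_eq_smul_one, TensorProduct.smul_tmul]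

theorem AdicCompletion.exists_pow_mul_eq_algebraMap (f : R)
    (hf : ∀ x : R', ∃ (n : ℕ) (r : R), algebraMap R R' f ^ n * x = algebraMap R R' r)
    (s : AdicCompletion I R ⊗[R] R') :
    ∃ (n : ℕ) (a : AdicCompletion I R),
      algebraMap (AdicCompletion I R) (AdicCompletion I R ⊗[R] R') (algebraMap R _ f) ^ n * s =
        algebraMap (AdicCompletion I R) _ a := by
  induction s with
  | zero => exact ⟨0, 0, by simp⟩
  | add s t hs ht =>
    obtain ⟨n, a, ha⟩ := hs
    obtain ⟨m, b, hb⟩ := ht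
    refine ⟨n + m, algebraMap R _ f ^ m * a + algebraMap R _ f ^ n * b, ?_⟩
    rw [_root_.map_add, map_mul, map_mul, ← ha, ← hb, map_pow, map_pow]
    ring
  | tmul a x =>
    obtain ⟨n, r, hr⟩ := hf x
    refine ⟨n, a * algebraMap R _ r, ?_⟩
    rw [algebraMap_tmul_eq, map_mul, algebraMap_tmul_eq, ← hr, Algebra.TensorProduct.tmul_pow,
      Algebra.TensorProduct.algebraMap_apply, Algebra.TensorProduct.tmul_mul_tmul,
      Algebra.TensorProduct.tmul_mul_tmul]
    simp

open AdicCompletion in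
/-- If `R'` is essentially of finite type over `R` and every element of `R'` becomes an element of
`R` after multiplication by a power of `f`, then the height of a prime ideal of `R̂'` not
containing `f` is at least the height of its contraction to `R̂`. -/
theorem height_comap_le_height_of_away [IsNoetherianRing R]
    [Algebra.EssFiniteType R R'] (hinj : Function.Injective (algebraMap R R'))
    (h : I ≤ I'.comap (algebraMap R R')) (f : R)
    (hf : ∀ x : R', ∃ (n : ℕ) (r : R), algebraMap R R' f ^ n * x = algebraMap R R' r)
    (P : Ideal (AdicCompletion I' R')) [P.IsPrime]
    (hP : algebraMap R' _ (algebraMap R R' f) ∉ P) :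
    ∃ φ : AdicCompletion I R →+* AdicCompletion I' R',
      (∀ r : R, φ (algebraMap R _ r) = algebraMap R' _ (algebraMap R R' r)) ∧
      (P.comap φ).height ≤ P.height := by
  have hI : I.FG := I.fg_of_isNoetherianRing
  have := AdicCompletion.isNoetherianRing I
  have : IsNoetherianRing (AdicCompletion I R ⊗[R] R') :=
    Algebra.EssFiniteType.isNoetherianRing (AdicCompletion I R) _
  have hE (r : R) : tensorCompletionEquiv I I' hI h (algebraMap (AdicCompletion I R ⊗[R] R') _
      (algebraMap (AdicCompletion I R) (AdicCompletion I R ⊗[R] R') (algebraMap R _ r))) =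
      algebraMap R' _ (algebraMap R R' r) := by
    rw [← tensorCompletionEquiv_algebraMap I I' hI h, algebraMap_tmul_eq]
  generalize tensorCompletionEquiv I I' hI h = E at hE
  have hP₁ : (P.comap E).IsPrime := Ideal.comap_isPrime E P
  refine ⟨E.toRingHom.comp ((algebraMap (AdicCompletion I R ⊗[R] R') _).comp
    (algebraMap (AdicCompletion I R) (AdicCompletion I R ⊗[R] R'))), fun r ↦ ?_, ?_⟩
  · rw [RingHom.comp_apply, RingHom.comp_apply]
    exact hE r
  rw [← RingEquiv.height_comap E P]
  refine le_trans (le_of_eq ?_) (Ideal.height_under_adicCompletion_le _ (P.comap E))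
  refine Ideal.height_under_eq_of_away (A := AdicCompletion I R)
    (S := AdicCompletion I R ⊗[R] R') ?_ (algebraMap R _ f) ?_ ((P.comap E).under _) ?_
  · exact Algebra.TensorProduct.includeLeft_injective (S := AdicCompletion I R) hinj
  · exact exists_pow_mul_eq_algebraMap I f hf
  · intro hmem
    apply hP
    rw [← hE]
    exact hmem
end

section
variable {A : Type*} [CommRing A] (I : Ideal A)

theorem AdicCompletion.algebraMap_mem_map_iff_of_pow_le {J : Ideal A} {n : ℕ} (hJ : I ^ n ≤ J)
    {r : A} : algebraMap A (AdicCompletion I A) r ∈ J.map (algebraMap A (AdicCompletion I A)) ↔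
      r ∈ J := by
  refine ⟨fun h ↦ ?_, Ideal.mem_map_of_mem _⟩
  have h1 := Ideal.mem_map_of_mem (evalₐ I n : AdicCompletion I A →+* A ⧸ I ^ n) h
  rw [Ideal.map_map] at h1
  have h2 : (evalₐ I n : AdicCompletion I A →+* A ⧸ I ^ n).comp
      (algebraMap A (AdicCompletion I A)) = Ideal.Quotient.mk (I ^ n) :=
    RingHom.ext fun r ↦ evalₐ_algebraMap I n r
  rw [h2, RingHom.coe_coe, evalₐ_algebraMap] at h1
  exact (Ideal.mem_quotient_iff_mem hJ).mp h1

theorem AdicCompletion.exists_sub_algebraMap_mem_map_of_pow_le (hI : I.FG) {J : Ideal A} {n : ℕ}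
    (hJ : I ^ n ≤ J) (x : AdicCompletion I A) :
    ∃ r, x - algebraMap A _ r ∈ J.map (algebraMap A (AdicCompletion I A)) := by
  obtain ⟨r, hr⟩ := exists_sub_algebraMap_mem I hI n x
  rw [← Ideal.map_pow] at hr
  exact ⟨r, Ideal.map_mono hJ hr⟩

end

section
variable {A K : Type*} [CommRing A] [Field K] (i : A →+* K)
  (ν : Valuation K ℝ≥0) (hν : ∀ x : A, ν (i x) ≤ 1)

theorem mem_valIdeal {γ : ℝ≥0} {x : A} : x ∈ valIdeal i ν hν γ ↔ ν (i x) ≤ γ := Iff.rfl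

theorem valIdeal_mono {γ δ : ℝ≥0} (h : γ ≤ δ) : valIdeal i ν hν γ ≤ valIdeal i ν hν δ :=
  fun _ hx ↦ le_trans hx h

theorem exists_pow_le_valIdeal {I : Ideal A} (hI : I.FG) (hlt : ∀ x ∈ I, ν (i x) < 1) {γ : ℝ≥0}
    (hγ : γ ≠ 0) : ∃ n : ℕ, I ^ n ≤ valIdeal i ν hν γ := by
  obtain ⟨s, rfl⟩ := hI
  set c := s.sup fun x ↦ ν (i x)
  have hc : c < 1 :=
    (Finset.sup_lt_iff (by simp)).mpr fun x hx ↦ hlt x (Ideal.subset_span hx)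
  have hle : Ideal.span (s : Set A) ≤ valIdeal i ν hν c :=
    Ideal.span_le.mpr fun x hx ↦ Finset.le_sup (f := fun x ↦ ν (i x)) hx
  have hpow (n : ℕ) : Ideal.span (s : Set A) ^ n ≤ valIdeal i ν hν (c ^ n) := by
    induction n with
    | zero => intro x _; simpa [mem_valIdeal] using hν x
    | succ n ih =>
      rw [pow_succ, Ideal.mul_le]
      intro x hx y hy
      rw [mem_valIdeal, map_mul, map_mul, pow_succ]
      exact mul_le_mul' (ih hx) (hle hy)
  obtain ⟨n, hn⟩ := exists_pow_lt_of_lt_one (pos_iff_ne_zero.mpr hγ) hc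
  exact ⟨n, (hpow n).trans (valIdeal_mono i ν hν hn.le)⟩

variable (hi : Function.Injective i)

include hi in
theorem ne_zero_of_mem_valSemigroup {γ : ℝ≥0} (hγ : γ ∈ valSemigroup i ν) : γ ≠ 0 := by
  obtain ⟨x, hx, rfl⟩ := hγ
  rwa [ne_eq, map_eq_zero, map_eq_zero_iff _ hi]

variable [IsLocalRing A]

theorem mem_implicitIdeal {x : AdicCompletion (maximalIdeal A) A} :
    x ∈ implicitIdeal i ν hν ↔ ∀ γ ∈ valSemigroup i ν,
      x ∈ (valIdeal i ν hν γ).map (algebraMap A (AdicCompletion (maximalIdeal A) A)) := by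
  simp only [implicitIdeal, Ideal.mem_iInf]

variable [IsNoetherianRing A] (hlt : ∀ x ∈ maximalIdeal A, ν (i x) < 1)

include hlt in
theorem algebraMap_mem_map_valIdeal_iff {γ : ℝ≥0} (hγ : γ ≠ 0) {x : A} :
    algebraMap A (AdicCompletion (maximalIdeal A) A) x ∈ (valIdeal i ν hν γ).map
      (algebraMap A (AdicCompletion (maximalIdeal A) A)) ↔ ν (i x) ≤ γ := by
  obtain ⟨n, hn⟩ :=
    exists_pow_le_valIdeal i ν hν (maximalIdeal A).fg_of_isNoetherianRing hlt hγ
  exact AdicCompletion.algebraMap_mem_map_iff_of_pow_le _ hn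

include hi hlt in
theorem algebraMap_mem_implicitIdeal_iff (hA : ¬ IsField A) [IsDomain A] {x : A} :
    algebraMap A (AdicCompletion (maximalIdeal A) A) x ∈ implicitIdeal i ν hν ↔ x = 0 := by
  refine ⟨fun h ↦ ?_, by rintro rfl; simp⟩
  by_contra hx
  obtain ⟨m, hm, hm0⟩ := Submodule.exists_mem_ne_zero_of_ne_bot
    (isField_iff_maximalIdeal_eq.not.mp hA)
  have hmem : ν (i (m * x)) ∈ valSemigroup i ν := ⟨m * x, mul_ne_zero hm0 hx, rfl⟩
  have h1 := (algebraMap_mem_map_valIdeal_iff i ν hν hlt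
    (ne_zero_of_mem_valSemigroup i ν hi hmem)).mp ((mem_implicitIdeal i ν hν).mp h _ hmem)
  rw [map_mul, map_mul] at h1
  have hpos : 0 < ν (i x) :=
    pos_iff_ne_zero.mpr (ne_zero_of_mem_valSemigroup i ν hi ⟨x, hx, rfl⟩)
  exact h1.not_gt (mul_lt_of_lt_one_left hpos (hlt m hm))

include hi hlt in
theorem implicitIdeal_isPrime (hA : ¬ IsField A) [IsDomain A] :
    (implicitIdeal i ν hν).IsPrime := by
  refine Ideal.isPrime_iff.mpr ⟨?_, fun {x y} hxy ↦ ?_⟩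
  · rw [Ideal.ne_top_iff_one, ← map_one (algebraMap A (AdicCompletion (maximalIdeal A) A)),
      algebraMap_mem_implicitIdeal_iff i ν hν hi hlt hA]
    exact one_ne_zero
  by_contra! hcon
  obtain ⟨hx, hy⟩ := hcon
  simp only [mem_implicitIdeal, not_forall] at hx hy
  obtain ⟨α, hα, hx⟩ := hx
  obtain ⟨β, hβ, hy⟩ := hy
  obtain ⟨a, ha0, ha⟩ := id hα
  obtain ⟨b, hb0, hb⟩ := id hβ
  have hγ : α * β ∈ valSemigroup i ν :=
    ⟨a * b, mul_ne_zero ha0 hb0, by rw [map_mul, map_mul, ha, hb]⟩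
  have hγ0 := ne_zero_of_mem_valSemigroup i ν hi hγ
  have hα1 : α ≤ 1 := ha ▸ hν a
  have hβ1 : β ≤ 1 := hb ▸ hν b
  set F := (valIdeal i ν hν (α * β)).map (algebraMap A (AdicCompletion (maximalIdeal A) A))
  have hFα : F ≤ (valIdeal i ν hν α).map (algebraMap A _) :=
    Ideal.map_mono (valIdeal_mono i ν hν (mul_le_of_le_one_right' hβ1))
  have hFβ : F ≤ (valIdeal i ν hν β).map (algebraMap A _) :=
    Ideal.map_mono (valIdeal_mono i ν hν (mul_le_of_le_one_left' hα1))
  have hfg := (maximalIdeal A).fg_of_isNoetherianRing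
  obtain ⟨n, hn⟩ := exists_pow_le_valIdeal i ν hν hfg hlt hγ0
  obtain ⟨r, hr⟩ := AdicCompletion.exists_sub_algebraMap_mem_map_of_pow_le _ hfg hn x
  obtain ⟨s, hs⟩ := AdicCompletion.exists_sub_algebraMap_mem_map_of_pow_le _ hfg hn y
  have hrα : α < ν (i r) := by
    by_contra! hle
    apply hx
    simpa using add_mem (hFα hr) (Ideal.mem_map_of_mem (algebraMap A _)
      ((mem_valIdeal i ν hν).mpr hle))
  have hsβ : β < ν (i s) := by
    by_contra! hle
    apply hy
    simpa using add_mem (hFβ hs) (Ideal.mem_map_of_mem (algebraMap A _)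
      ((mem_valIdeal i ν hν).mpr hle))
  have hrs : algebraMap A (AdicCompletion (maximalIdeal A) A) (r * s) ∈ F := by
    have h1 := (mem_implicitIdeal i ν hν).mp hxy _ hγ
    have h2 := sub_mem (sub_mem h1 (F.mul_mem_right y hr))
      (F.mul_mem_left (algebraMap A _ r) hs)
    rw [map_mul]
    convert h2 using 1
    ring
  rw [algebraMap_mem_map_valIdeal_iff i ν hν hlt hγ0, map_mul, map_mul] at hrs
  exact hrs.not_gt (mul_lt_mul'' hrα hsβ zero_le zero_le)

end

theorem implicitIdeal_le_comap {A B K : Type*} [CommRing A] [CommRing B] [IsLocalRing A]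
    [IsLocalRing B] [IsDomain A] [Field K] (hA : ¬ IsField A)
    (π : A →+* B) (i : B →+* K) (hi : Function.Injective i)
    (ν : Valuation K ℝ≥0) (hν : ∀ x : B, ν (i x) ≤ 1)
    (hlt : ∀ x ∈ maximalIdeal A, ν (i (π x)) < 1)
    (φ : AdicCompletion (maximalIdeal A) A →+* AdicCompletion (maximalIdeal B) B)
    (hφ : ∀ r, φ (algebraMap A _ r) = algebraMap B _ (π r)) :
    implicitIdeal (i.comp π) ν (fun x ↦ hν (π x)) ≤ (implicitIdeal i ν hν).comap φ := by
  intro x hx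
  rw [Ideal.mem_comap, mem_implicitIdeal]
  intro γ hγ
  obtain ⟨m, hm, hm0⟩ := Submodule.exists_mem_ne_zero_of_ne_bot
    (isField_iff_maximalIdeal_eq.not.mp hA)
  obtain ⟨n, hn⟩ := exists_pow_lt_of_lt_one
    (pos_iff_ne_zero.mpr (ne_zero_of_mem_valSemigroup i ν hi hγ)) (hlt m hm)
  have h1 := (mem_implicitIdeal _ ν _).mp hx (ν (i (π m)) ^ n)
    ⟨m ^ n, pow_ne_zero n hm0, by simp⟩
  suffices h : (valIdeal (i.comp π) ν (fun x ↦ hν (π x)) (ν (i (π m)) ^ n)).map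
      (algebraMap A (AdicCompletion (maximalIdeal A) A)) ≤
      ((valIdeal i ν hν γ).map (algebraMap B _)).comap φ from h h1
  rw [Ideal.map_le_iff_le_comap]
  intro r hr
  rw [Ideal.mem_comap, Ideal.mem_comap, hφ]
  exact Ideal.mem_map_of_mem _ (le_trans hr hn.le)

theorem idealHeight_le_height {A : Type*} [CommRing A] {I P : Ideal A} [hP : P.IsPrime]
    (h : I ≤ P) : idealHeight I ≤ P.height := by
  rw [PrimeSpectrum.height_eq_orderHeight ⟨P, hP⟩]
  exact iInf₂_le (⟨P, hP⟩ : PrimeSpectrum A) h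

theorem height_le_idealHeight {A : Type*} [CommRing A] (P : Ideal A) [hP : P.IsPrime] :
    P.height ≤ idealHeight P := by
  rw [PrimeSpectrum.height_eq_orderHeight ⟨P, hP⟩]
  exact le_iInf₂ fun Q hQ ↦ Order.height_mono (show (⟨P, hP⟩ : PrimeSpectrum A) ≤ Q from hQ)

/-- Assume in addition that `R'` is essentially of finite type over `R`
(a localization of a finitely generated `R`-algebra) and that there is a nonzero `f ∈ R` such
that the induced homomorphism `R_f → R'_{π(f)}` is bijective (`π` is a local blowing up, an
isomorphism away from `f = 0`).  Then the height of the implicit ideal does not decrease: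
`ht H' ≥ ht H`. -/
theorem idealHeight_implicitIdeal_le
    (R R' : Type*) [CommRing R] [CommRing R'] [IsDomain R] [IsDomain R']
    [IsNoetherianRing R] [IsNoetherianRing R'] [IsLocalRing R] [IsLocalRing R']
    (hR : ¬ IsField R) (hR' : ¬ IsField R')
    (π : R →+* R') (hinj : Function.Injective π)
    (hloc : ∀ x ∈ maximalIdeal R, π x ∈ maximalIdeal R')
    (heft : @Algebra.EssFiniteType R R' _ _ π.toAlgebra)
    (hblow : ∃ f : R, f ≠ 0 ∧ Function.Bijective (Localization.awayMap π f))
    (ν' : Valuation (FractionRing R') ℝ≥0)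
    (hν'1 : ∀ x : R', ν' (algebraMap R' (FractionRing R') x) ≤ 1)
    (hν'2 : ∀ x ∈ maximalIdeal R', ν' (algebraMap R' (FractionRing R') x) < 1) :
    idealHeight (implicitIdeal ((algebraMap R' (FractionRing R')).comp π) ν'
        (fun x => hν'1 (π x))) ≤
      idealHeight (implicitIdeal (algebraMap R' (FractionRing R')) ν' hν'1) := by
  obtain ⟨f, hf0, hf⟩ := hblow
  let := π.toAlgebra
  have hi := IsFractionRing.injective R' (FractionRing R')
  have hprime := implicitIdeal_isPrime _ ν' hν'1 hi hν'2 hR'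
  have hfP : algebraMap R' _ (π f) ∉ implicitIdeal (algebraMap R' (FractionRing R')) ν' hν'1 := by
    rwa [algebraMap_mem_implicitIdeal_iff _ ν' hν'1 hi hν'2 hR', map_eq_zero_iff _ hinj]
  obtain ⟨φ, hφ, hle⟩ := height_comap_le_height_of_away (maximalIdeal R) (maximalIdeal R') hinj
    hloc f (fun x ↦ by
      obtain ⟨b, n, h⟩ := Localization.awayMap_surjective_iff.mp hf.2 x
      exact ⟨n, b, h.symm⟩) _ hfP
  calc
    _ ≤ ((implicitIdeal (algebraMap R' (FractionRing R')) ν' hν'1).comap φ).height :=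
      idealHeight_le_height <| implicitIdeal_le_comap hR π _ hi ν' hν'1
        (fun x hx ↦ hν'2 _ (hloc x hx)) φ hφ
    _ ≤ _ := hle
    _ ≤ _ := height_le_idealHeight _
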